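/- Let F := (z₂ − 2)² − (z₁ − 1)(z₁⁵ + 2z₁ + 5)² ∈ ℂ[z₁,z₂], and let ζ ∈ ℂ satisfy ζ⁵ + 2ζ + 5 = 0 (so (ζ,2) is a singular point of the curve V(F)). For generic (a₁, a₂) ∈ ℂ², the set {z ∈ (ℂ*)² : F(z) = 0, a₁(z₁ − ζ) + a₂(z₂ − 2) = 0, and z ≠ (ζ, 2)} has exactly 9 elements. (The second removal ML degree of the hyperelliptic curve with respect to each singular point is r₂ = 9.) -/

import Mathlib

open MvPolynomial

/-- The hyperelliptic curve `(y − 2)² = (x − 1)(x⁵ + 2x + 5)²`. -/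
noncomputable def hyperF : MvPolynomial (Fin 2) ℂ :=
  (X 1 - 2) ^ 2 - (X 0 - 1) * (X 0 ^ 5 + 2 * X 0 + 5) ^ 2

/-- A nonconstant complex polynomial takes all but finitely many values exactly
`natDegree` times, without multiplicity. -/
theorem exists_finset_card_fiber_eq_natDegree (h : Polynomial ℂ) (hd : 0 < h.natDegree) :
    ∃ V : Finset ℂ, ∀ c ∉ V,
      (h - Polynomial.C c).roots.toFinset.card = h.natDegree := by
  classical
  have hder : Polynomial.derivative h ≠ 0 := fun h0 =>
    hd.ne' (Polynomial.derivative_eq_zero.1 h0)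
  refine ⟨(Polynomial.derivative h).roots.toFinset.image (fun x => h.eval x), fun c hc => ?_⟩
  have hdeg : (h - Polynomial.C c).natDegree = h.natDegree := Polynomial.natDegree_sub_C
  have hne : h - Polynomial.C c ≠ 0 := by
    intro h0
    rw [h0, Polynomial.natDegree_zero] at hdeg
    omega
  have hnodup : (h - Polynomial.C c).roots.Nodup := by
    rw [Multiset.nodup_iff_count_le_one]
    intro x
    rw [Polynomial.count_roots]
    by_contra! hlt
    obtain ⟨hx, hx'⟩ := (Polynomial.one_lt_rootMultiplicity_iff_isRoot hne).1 hlt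
    apply hc
    rw [Finset.mem_image]
    refine ⟨x, ?_, ?_⟩
    · rw [Multiset.mem_toFinset, Polynomial.mem_roots hder]
      simpa using hx'
    · simpa [sub_eq_zero] using hx
  rw [Multiset.toFinset_card_of_nodup hnodup, ← hdeg]
  exact (IsAlgClosed.splits _).natDegree_eq_card_roots.symm

/-- A property of the slope `-a₀ / a₁` that fails for only finitely many slopes holds for
generic `(a₀, a₁)`. -/
theorem exists_ne_zero_of_finset_slopes (B : Finset ℂ) :
    ∃ g : MvPolynomial (Fin 2) ℂ, g ≠ 0 ∧
      ∀ a : Fin 2 → ℂ, eval a g ≠ 0 → a 1 ≠ 0 ∧ -a 0 / a 1 ∉ B := by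
  refine ⟨X 1 * ∏ b ∈ B, (X 0 + C b * X 1), ?_, fun a ha => ?_⟩
  · refine mul_ne_zero (X_ne_zero _) (Finset.prod_ne_zero_iff.2 fun b _ h0 => ?_)
    have := congrArg (eval ![1, 0]) h0
    simp at this
  · simp only [map_mul, eval_X, map_prod, map_add, eval_C] at ha
    have h1 : a 1 ≠ 0 := left_ne_zero_of_mul ha
    refine ⟨h1, fun hB => Finset.prod_ne_zero_iff.1 (right_ne_zero_of_mul ha) _ hB ?_⟩
    field_simp
    ring

/-- The quotient of `x⁵ + 2x + 5` by `x - ζ`, for a root `ζ`. -/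
noncomputable def quinticQuotient (ζ : ℂ) : Polynomial ℂ :=
  Polynomial.X ^ 4 + Polynomial.C ζ * Polynomial.X ^ 3 + Polynomial.C (ζ ^ 2) * Polynomial.X ^ 2
    + Polynomial.C (ζ ^ 3) * Polynomial.X + Polynomial.C (ζ ^ 4 + 2)

theorem sub_mul_eval_quinticQuotient {ζ : ℂ} (hζ : ζ ^ 5 + 2 * ζ + 5 = 0) (x : ℂ) :
    (x - ζ) * (quinticQuotient ζ).eval x = x ^ 5 + 2 * x + 5 := by
  simp only [quinticQuotient, Polynomial.eval_add, Polynomial.eval_mul, Polynomial.eval_pow,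
    Polynomial.eval_X, Polynomial.eval_C]
  linear_combination -hζ

/-- The squared slope of the line joining `(ζ, 2)` to a point of the curve, as a polynomial in
the first coordinate of that point. -/
noncomputable def squaredSlope (ζ : ℂ) : Polynomial ℂ :=
  (Polynomial.X - Polynomial.C 1) * quinticQuotient ζ ^ 2

theorem natDegree_squaredSlope (ζ : ℂ) : (squaredSlope ζ).natDegree = 9 := by
  have hq : (quinticQuotient ζ).natDegree = 4 := by
    unfold quinticQuotient
    compute_degree!
  have hq0 : quinticQuotient ζ ≠ 0 := by
    intro h0
    simp [h0] at hq
  rw [squaredSlope, Polynomial.natDegree_mul (Polynomial.X_sub_C_ne_zero 1) (pow_ne_zero 2 hq0),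
    Polynomial.natDegree_X_sub_C, Polynomial.natDegree_pow, hq]

theorem sub_sq_mul_eval_squaredSlope {ζ : ℂ} (hζ : ζ ^ 5 + 2 * ζ + 5 = 0) (x : ℂ) :
    (x - ζ) ^ 2 * (squaredSlope ζ).eval x = (x - 1) * (x ^ 5 + 2 * x + 5) ^ 2 := by
  rw [← sub_mul_eval_quinticQuotient hζ x]
  simp only [squaredSlope, Polynomial.eval_mul, Polynomial.eval_sub, Polynomial.eval_pow,
    Polynomial.eval_X, Polynomial.eval_C]
  ring

theorem eval_hyperF (z : Fin 2 → ℂ) :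
    eval z hyperF = (z 1 - 2) ^ 2 - (z 0 - 1) * (z 0 ^ 5 + 2 * z 0 + 5) ^ 2 := by
  simp [hyperF]

/-- Only finitely many slopes `t` make the line of slope `t` through `(ζ, 2)` meet the curve
on the first coordinate axis away from `x = ζ`. -/
theorem exists_finset_slopes_second_coord_ne_zero (ζ : ℂ) :
    ∃ B : Finset ℂ, ∀ t ∉ B, ∀ x ≠ ζ, (squaredSlope ζ).eval x = t ^ 2 →
      2 + t * (x - ζ) ≠ 0 := by
  classical
  let G : Polynomial ℂ := (Polynomial.X - Polynomial.C ζ) ^ 2 * squaredSlope ζ - Polynomial.C 4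
  have hG : ∀ x, G.eval x = (x - ζ) ^ 2 * (squaredSlope ζ).eval x - 4 := fun x => by simp [G]
  have hG0 : G ≠ 0 := by
    intro h0
    have h1 := hG ζ
    simp [h0] at h1
  refine ⟨G.roots.toFinset.image (fun x => -2 / (x - ζ)), fun t ht x hx hxt hy => ht ?_⟩
  have hx' : x - ζ ≠ 0 := sub_ne_zero.2 hx
  rw [Finset.mem_image]
  refine ⟨x, ?_, ?_⟩
  · rw [Multiset.mem_toFinset, Polynomial.mem_roots hG0, Polynomial.IsRoot, hG, hxt]
    linear_combination (t * (x - ζ) - 2) * hy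
  · field_simp
    linear_combination -hy

/-- **The second removal ML degree of the hyperelliptic curve with respect to each of
its singular points is `r₂ = 9`.**  Let `ζ` be a root of `x⁵ + 2x + 5`, so that
`(ζ, 2)` is a singular point of the curve.  For generic `(a₁, a₂) ∈ ℂ²`, the general
line `a₁(z₁ − ζ) + a₂(z₂ − 2) = 0` through `(ζ, 2)` meets the curve in exactly `9`
torus points other than `(ζ, 2)` itself. -/
theorem hyperelliptic_removal_ml_degree_two_singular (ζ : ℂ) (hζ : ζ ^ 5 + 2 * ζ + 5 = 0) :
    ∃ g : MvPolynomial (Fin 2) ℂ, g ≠ 0 ∧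
      ∀ a : Fin 2 → ℂ, eval a g ≠ 0 →
        {z : Fin 2 → ℂ | (∀ i, z i ≠ 0) ∧ eval z hyperF = 0 ∧
            a 0 * (z 0 - ζ) + a 1 * (z 1 - 2) = 0 ∧ z ≠ ![ζ, 2]}.ncard = 9 := by
  classical
  obtain ⟨V, hV⟩ := exists_finset_card_fiber_eq_natDegree (squaredSlope ζ)
    (by rw [natDegree_squaredSlope]; norm_num)
  obtain ⟨B, hB⟩ := exists_finset_slopes_second_coord_ne_zero ζ
  let W : Finset ℂ := V ∪ {(squaredSlope ζ).eval 0, (squaredSlope ζ).eval ζ}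
  obtain ⟨g, hg, hgen⟩ := exists_ne_zero_of_finset_slopes
    (B ∪ W.biUnion fun v => (Polynomial.nthRoots 2 v).toFinset)
  refine ⟨g, hg, fun a ha => ?_⟩
  obtain ⟨ha1, hslope⟩ := hgen a ha
  set t : ℂ := -a 0 / a 1 with ht
  have hat : a 0 = -t * a 1 := by rw [ht]; field_simp
  rw [Finset.mem_union, not_or] at hslope
  have htW : t ^ 2 ∉ W := fun hmem => hslope.2 <| Finset.mem_biUnion.2
    ⟨t ^ 2, hmem, by rw [Multiset.mem_toFinset, Polynomial.mem_nthRoots two_pos]⟩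
  simp only [W, Finset.mem_union, Finset.mem_insert, Finset.mem_singleton, not_or] at htW
  obtain ⟨htV, ht0, htζ⟩ := htW
  have hcard := hV _ htV
  rw [natDegree_squaredSlope] at hcard
  have hne : squaredSlope ζ - Polynomial.C (t ^ 2) ≠ 0 := by
    intro h0
    rw [h0] at hcard
    simp at hcard
  have hmem : ∀ x, x ∈ (squaredSlope ζ - Polynomial.C (t ^ 2)).roots.toFinset ↔
      (squaredSlope ζ).eval x = t ^ 2 := fun x => by
    rw [Multiset.mem_toFinset, Polynomial.mem_roots hne, Polynomial.IsRoot, Polynomial.eval_sub,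
      Polynomial.eval_C, sub_eq_zero]
  have hinj : Function.Injective (fun x : ℂ => ![x, 2 + t * (x - ζ)]) := fun x y hxy => by
    simpa using congrFun hxy 0
  rw [← hcard, ← Set.ncard_coe_finset, ← Set.ncard_image_of_injective _ hinj]
  congr 1
  ext z
  simp only [Set.mem_ofPred_eq, Set.mem_image, Finset.mem_coe, hmem, eval_hyperF]
  constructor
  · rintro ⟨-, hF, hline, hz⟩
    have hz1 : z 1 = 2 + t * (z 0 - ζ) := by
      apply mul_left_cancel₀ ha1
      rw [hat] at hline
      linear_combination hline
    have hzeq : ![z 0, 2 + t * (z 0 - ζ)] = z := by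
      ext i
      fin_cases i <;> simp [hz1]
    refine ⟨z 0, ?_, hzeq⟩
    have hzζ : z 0 - ζ ≠ 0 := by
      intro h0
      apply hz
      rw [← hzeq, h0, sub_eq_zero.1 h0]
      simp
    apply mul_left_cancel₀ (pow_ne_zero 2 hzζ)
    rw [sub_sq_mul_eval_squaredSlope hζ]
    rw [hz1] at hF
    linear_combination -hF
  · rintro ⟨x, hx, rfl⟩
    have hx0 : x ≠ 0 := by
      rintro rfl
      exact ht0 hx.symm
    have hxζ : x ≠ ζ := by
      rintro rfl
      exact htζ hx.symm
    refine ⟨fun i => ?_, ?_, ?_, fun h => hxζ (by simpa using congrFun h 0)⟩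
    · fin_cases i
      · simpa using hx0
      · simpa using hB t hslope.1 x hxζ hx
    · have := sub_sq_mul_eval_squaredSlope hζ x
      simp only [Matrix.cons_val_zero, Matrix.cons_val_one]
      rw [← this, hx]
      ring
    · simp only [Matrix.cons_val_zero, Matrix.cons_val_one]
      rw [hat]
      ring
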